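/- arXiv:2005.13620 — 2 statements merged into one kernel-verified Lean document; each statement's English description precedes it below -/
import Mathlib

section
/- For any integer k ≥ 1, as an identity of formal power series in q, ∑_{n₁,…,n_{2k}≥0} q^{∑_{i=1}^{2k} n_i² − ∑_{i=1}^{2k-1} n_i n_{i+1}} / ∏_{i=1}^{2k} (q;q)_{n_i}² equals 1/(q;q)_∞^{2k} times ∑_{n₁,…,n_{2k-1}≥0} q^{∑_{i=1}^{2k-1} n_i² − ∑_{i=1}^{2k-2} n_i n_{i+1}} / ∏_{i=1}^{2k-1} (q;q)_{n_i}. -/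
open PowerSeries

/-- Product (coefficientwise) topology on formal power series over ℚ. -/
instance : TopologicalSpace (PowerSeries ℚ) :=
  inferInstanceAs (TopologicalSpace ((Unit →₀ ℕ) → ℚ))

/-- `(q;q)_n` as a formal power series in `q = X`. -/
noncomputable def qpX (n : ℕ) : PowerSeries ℚ :=
  ∏ i ∈ Finset.range n, (1 - (X : PowerSeries ℚ) ^ (i + 1))

/-- `(q;q)_∞` as a formal power series in `q = X` (coefficientwise convergent product). -/
noncomputable def qpXInf : PowerSeries ℚ :=
  ∏' i : ℕ, (1 - (X : PowerSeries ℚ) ^ (i + 1))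


open Filter Topology

instance instRingTop : IsTopologicalRing (PowerSeries ℚ) :=
  PowerSeries.WithPiTopology.instIsTopologicalRing ℚ

instance instT2Top : T2Space (PowerSeries ℚ) :=
  PowerSeries.WithPiTopology.instT2Space ℚ

theorem hasSum_coeff {ι : Type*} {f : ι → PowerSeries ℚ} {g : PowerSeries ℚ} :
    HasSum f g ↔ ∀ d, HasSum (fun i ↦ coeff d (f i)) (coeff d g) :=
  PowerSeries.WithPiTopology.hasSum_iff_hasSum_coeff ℚ

theorem summable_coeff {ι : Type*} {f : ι → PowerSeries ℚ} :
    Summable f ↔ ∀ d, Summable (fun i ↦ coeff d (f i)) :=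
  PowerSeries.WithPiTopology.summable_iff_summable_coeff ℚ

theorem tendsto_coeff {ι : Type*} (f : ι → PowerSeries ℚ) (u : Filter ι) (g : PowerSeries ℚ) :
    Tendsto f u (nhds g) ↔ ∀ d : ℕ, Tendsto (fun i => coeff d (f i)) u (nhds (coeff d g)) :=
  PowerSeries.WithPiTopology.tendsto_iff_coeff_tendsto ℚ f u g

theorem multip : Multipliable fun n : ℕ ↦ (1 : PowerSeries ℚ) - X ^ (n + 1) :=
  PowerSeries.WithPiTopology.multipliable_one_sub_X_pow ℚ

/-- order tends to infinity -/
def PSmall {ι : Type*} (f : ι → PowerSeries ℚ) : Prop :=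
  ∀ d : ℕ, {i | ¬ (X : PowerSeries ℚ) ^ d ∣ f i}.Finite

theorem PSmall.summable {ι : Type*} {f : ι → PowerSeries ℚ} (h : PSmall f) : Summable f := by
  rw [summable_coeff]
  intro d
  refine summable_of_hasFiniteSupport ((h (d+1)).subset ?_)
  intro i hi hdvd
  exact hi ((X_pow_dvd_iff.1 hdvd) d (Nat.lt_succ_self d))

theorem dvd_of_hasSum {ι : Type*} {f : ι → PowerSeries ℚ} {a : PowerSeries ℚ} {d : ℕ}
    (h : HasSum f a) (hf : ∀ i, (X : PowerSeries ℚ) ^ d ∣ f i) : (X : PowerSeries ℚ) ^ d ∣ a := by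
  rw [X_pow_dvd_iff]
  intro m hm
  have h1 := hasSum_coeff.1 h m
  have h2 : (fun i => coeff m (f i)) = fun _ => 0 := by
    funext i
    exact X_pow_dvd_iff.1 (hf i) m hm
  rw [h2] at h1
  exact h1.unique hasSum_zero

theorem eq_of_dvd {a b : PowerSeries ℚ} (h : ∀ d : ℕ, (X : PowerSeries ℚ) ^ d ∣ a - b) : a = b := by
  ext m
  have := X_pow_dvd_iff.1 (h (m+1)) m (Nat.lt_succ_self m)
  rw [map_sub] at this
  linarith

theorem PSmall.prod {m : ℕ} {f : Fin m → ℕ → PowerSeries ℚ} (h : ∀ i, PSmall (f i)) :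
    PSmall (fun n : Fin m → ℕ => ∏ i, f i (n i)) := by
  intro d
  refine (Set.Finite.pi (t := fun i => {x | ¬ (X : PowerSeries ℚ) ^ d ∣ f i x})
    (fun i => h i d)).subset ?_
  intro n hn i _ hd
  exact hn (hd.trans (Finset.dvd_prod_of_mem (fun i => f i (n i)) (Finset.mem_univ i)))

theorem hasSum_pi {m : ℕ} {f : Fin m → ℕ → PowerSeries ℚ} {a : Fin m → PowerSeries ℚ}
    (h : ∀ i, PSmall (f i)) (hs : ∀ i, HasSum (f i) (a i)) :
    HasSum (fun n : Fin m → ℕ => ∏ i, f i (n i)) (∏ i, a i) := by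
  induction m with
  | zero =>
    simp only [Finset.univ_eq_empty, Finset.prod_empty]
    exact hasSum_unique (fun _ : Fin 0 → ℕ => (1 : PowerSeries ℚ))
  | succ m ih =>
    have ih := ih (fun i : Fin m => h i.succ) (fun i => hs i.succ)
    have hS : Summable (fun n : Fin (m+1) → ℕ => ∏ i, f i (n i)) := (PSmall.prod h).summable
    rw [← (Fin.consEquiv (fun _ : Fin (m+1) => ℕ)).summable_iff] at hS
    rw [← (Fin.consEquiv (fun _ : Fin (m+1) => ℕ)).hasSum_iff]
    have e : ((fun n : Fin (m+1) → ℕ => ∏ i, f i (n i)) ∘ (Fin.consEquiv (fun _ : Fin (m+1) => ℕ)))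
       = fun x : ℕ × (Fin m → ℕ) => f 0 x.1 * ∏ i : Fin m, f i.succ (x.2 i) := by
      funext x
      simp [Fin.prod_univ_succ, Fin.consEquiv]
    rw [e] at hS ⊢
    rw [Fin.prod_univ_succ]
    exact HasSum.mul (f := f 0) (g := fun y : Fin m → ℕ => ∏ i : Fin m, f i.succ (y i))
      (s := a 0) (t := ∏ i : Fin m, a i.succ) (hs 0) ih hS

noncomputable def iq (n : ℕ) : PowerSeries ℚ := (qpX n)⁻¹

theorem cc_qpX (n : ℕ) : constantCoeff (qpX n) = 1 := by
  simp [qpX, map_prod]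

theorem qpX_mul_iq (n : ℕ) : qpX n * iq n = 1 :=
  PowerSeries.mul_inv_cancel _ (by rw [cc_qpX]; exact one_ne_zero)

theorem qpX_succ (n : ℕ) : qpX (n+1) = qpX n * (1 - X ^ (n+1)) := by
  simp [qpX, Finset.prod_range_succ]

theorem iq_succ (n : ℕ) : iq n = (1 - X ^ (n+1)) * iq (n+1) := by
  have h1 := qpX_mul_iq n
  have h2 := qpX_mul_iq (n+1)
  rw [qpX_succ] at h2
  linear_combination (-iq n) * h2 + (1 - X ^ (n+1)) * iq (n+1) * h1

theorem iq_zero : iq 0 = 1 := by simpa [qpX] using qpX_mul_iq 0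

theorem iq_prod {m : ℕ} (f : Fin m → PowerSeries ℚ) : (∏ i, f i)⁻¹ = ∏ i, (f i)⁻¹ := by
  induction m with
  | zero => simp
  | succ m ih => rw [Fin.prod_univ_succ, PowerSeries.mul_inv_rev, ih, Fin.prod_univ_succ, mul_comm]

theorem iq_pow (f : PowerSeries ℚ) (m : ℕ) : (f ^ m)⁻¹ = f⁻¹ ^ m := by
  induction m with
  | zero => simp
  | succ m ih => rw [pow_succ, PowerSeries.mul_inv_rev, ih, pow_succ, mul_comm]

theorem qpX_cong (d n : ℕ) (h : d ≤ n) : (X : PowerSeries ℚ) ^ d ∣ qpX n - qpX d := by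
  induction n, h using Nat.le_induction with
  | base => simp
  | succ n hn ih =>
    have : qpX (n+1) - qpX d = (qpX n - qpX d) - X ^ (n+1) * qpX n := by rw [qpX_succ]; ring
    rw [this]
    exact dvd_sub ih (Dvd.dvd.mul_right (pow_dvd_pow _ (by omega)) _)

theorem qinf_cong (d n : ℕ) (h : d ≤ n) : (X : PowerSeries ℚ) ^ d ∣ qpX n - qpXInf := by
  have h1 := multip.hasProd.tendsto_prod_nat
  change Tendsto (fun n => qpX n) atTop (𝓝 qpXInf) at h1
  rw [tendsto_coeff] at h1
  rw [X_pow_dvd_iff]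
  intro m hm
  rw [map_sub]
  have h2 : Tendsto (fun k => coeff m (qpX k)) atTop (𝓝 (coeff m (qpX n))) := by
    refine tendsto_atTop_of_eventually_const (i₀ := n) ?_
    intro k hk
    have := X_pow_dvd_iff.1 (qpX_cong n k hk) m (by omega)
    rw [map_sub] at this
    linarith
  have := tendsto_nhds_unique h2 (h1 m)
  linarith

noncomputable def iinf : PowerSeries ℚ := qpXInf⁻¹

theorem cc_qinf : constantCoeff qpXInf = 1 := by
  have := X_pow_dvd_iff.1 (qinf_cong 1 1 le_rfl) 0 (by norm_num)
  rw [map_sub, coeff_zero_eq_constantCoeff_apply, coeff_zero_eq_constantCoeff_apply, cc_qpX] at this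
  linarith

theorem qinf_mul_iinf : qpXInf * iinf = 1 :=
  PowerSeries.mul_inv_cancel _ (by rw [cc_qinf]; exact one_ne_zero)

theorem iinf_cong (d n : ℕ) (h : d ≤ n) : (X : PowerSeries ℚ) ^ d ∣ iq n - iinf := by
  have h1 := qpX_mul_iq n
  have h2 := qinf_mul_iinf
  have : iq n - iinf = (qpX n - qpXInf) * (- iq n * iinf) := by
    linear_combination iinf * h1 - iq n * h2
  rw [this]
  exact Dvd.dvd.mul_right (qinf_cong d n h) _

/-- 1/(q)_{a-b} -/
noncomputable def rq (a b : ℕ) : PowerSeries ℚ := if b ≤ a then iq (a - b) else 0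

theorem rq_lt {a b : ℕ} (h : a < b) : rq a b = 0 := if_neg (by omega)
theorem rq_add (b c : ℕ) : rq (b + c) b = iq c := by simp [rq]

noncomputable def PT (a b j : ℕ) : PowerSeries ℚ :=
  X ^ ((a - j) * (b - j)) * (iq j * rq a j * rq b j)

theorem PT_lt_left {a b j : ℕ} (h : a < j) : PT a b j = 0 := by simp [PT, rq_lt h]
theorem PT_lt_right {a b j : ℕ} (h : b < j) : PT a b j = 0 := by simp [PT, rq_lt h]

theorem PT_rec (a b : ℕ) : (1 - X ^ (a+1)) * ∑ j ∈ Finset.range (a + 2), PT (a+1) b j =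
    ∑ j ∈ Finset.range (a + 1), PT a b j := by
  set U : ℕ → PowerSeries ℚ := fun j => X ^ ((a + 1 - j) * (b - j)) * (iq j * rq a j * rq b j) with hU
  set V : ℕ → PowerSeries ℚ := fun j =>
    X ^ ((a - j) * (b - j)) * (iq j * rq a j * rq b (j+1)) with hV
  have h0 : (1 - X ^ (a+1)) * PT (a+1) b 0 = U 0 := by
    simp only [PT, hU, Nat.sub_zero]
    have : rq (a+1) 0 = iq (a+1) := by simp [rq]
    rw [this]
    have : rq a 0 = iq a := by simp [rq]
    rw [this, iq_succ a]; ring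
  have h1 : ∀ j ∈ Finset.range (a+1), (1 - X ^ (a+1)) * PT (a+1) b (j+1) = U (j+1) + V j := by
    intro j hj
    obtain ⟨c, rfl⟩ := Nat.exists_eq_add_of_le (Nat.lt_succ_iff.1 (Finset.mem_range.1 hj))
    rcases Nat.lt_or_ge b (j+1) with hb | hb
    · simp [PT, hU, hV, rq_lt hb]
    obtain ⟨e, rfl⟩ := Nat.exists_eq_add_of_le hb
    have e1 : j + c + 1 - (j + 1) = c := by omega
    have e2 : j + 1 + e - (j + 1) = e := by omega
    have e3 : j + 1 + e - j = e + 1 := by omega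
    have e4 : j + c - j = c := by omega
    have e5 : rq (j + c + 1) (j + 1) = iq c := by
      rw [show j + c + 1 = j + 1 + c by ring, rq_add]
    simp only [PT, hU, hV, e1, e2, e3, e4, e5, rq_add]
    rw [iq_succ j]
    rcases c with _ | c
    · rw [rq_lt (show j + 0 < j + 1 by omega)]
      simp
      ring
    · rw [show j + (c + 1) = j + 1 + c by ring, rq_add, iq_succ c]
      ring
  have h2 : ∀ j ∈ Finset.range (a+1), PT a b j = U j + V j := by
    intro j hj
    obtain ⟨c, rfl⟩ := Nat.exists_eq_add_of_le (Nat.lt_succ_iff.1 (Finset.mem_range.1 hj))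
    rcases Nat.lt_or_ge b j with hb | hb
    · simp [PT, hU, hV, rq_lt hb, rq_lt (show b < j + 1 by omega)]
    obtain ⟨e, rfl⟩ := Nat.exists_eq_add_of_le hb
    have e1 : j + c + 1 - j = c + 1 := by omega
    have e2 : j + e - j = e := by omega
    have e4 : j + c - j = c := by omega
    simp only [PT, hU, hV, e1, e2, e4, rq_add]
    rcases e with _ | e
    · rw [rq_lt (show j + 0 < j + 1 by omega)]
      simp
    · rw [show j + (e + 1) = j + 1 + e by ring, rq_add, iq_succ e]
      ring
  have hUl : U (a+1) = 0 := by simp [hU, rq_lt (Nat.lt_succ_self a)]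
  rw [Finset.sum_congr rfl h2, Finset.sum_add_distrib, Finset.sum_range_succ' _ (a+1), mul_add,
    Finset.mul_sum, Finset.sum_congr rfl h1, h0, Finset.sum_add_distrib]
  have h3 := Finset.sum_range_succ U (a+1)
  rw [Finset.sum_range_succ' U (a+1), hUl] at h3
  linear_combination h3

theorem pentagon (a b : ℕ) : ∑ j ∈ Finset.range (a + 1), PT a b j = iq a * iq b := by
  induction a with
  | zero => simp [PT, rq, iq_zero]
  | succ a ih =>
    have h := PT_rec a b
    rw [ih, iq_succ a] at h
    have h2 : (1 - X ^ (a+1) : PowerSeries ℚ) ≠ 0 := by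
      intro h0
      have := qpX_mul_iq (a+1)
      rw [qpX_succ, h0] at this
      simp at this
    apply mul_left_cancel₀ h2
    rw [h]; ring

theorem PT_small (a b : ℕ) : PSmall (PT a b) := by
  intro d
  refine (Finset.range (a+1)).finite_toSet.subset ?_
  intro j hj
  by_contra h
  apply hj
  rw [PT_lt_left (by simpa using h)]
  exact dvd_zero _

theorem PT_hasSum (a b : ℕ) : HasSum (PT a b) (iq a * iq b) := by
  rw [← pentagon]
  apply hasSum_sum_of_ne_finset_zero
  intro j hj
  exact PT_lt_left (by simpa using hj)

noncomputable def DT (a b n : ℕ) : PowerSeries ℚ :=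
  X ^ ((n - a) * (n - b)) * (rq n a * rq n b)

theorem DT_dvd (a b n d : ℕ) (h : a + b + d ≤ n) : (X : PowerSeries ℚ) ^ d ∣ DT a b n := by
  apply Dvd.dvd.mul_right
  apply pow_dvd_pow
  have h1 : d ≤ n - a := by omega
  have h2 : d ≤ n - b := by omega
  calc d ≤ d * d := Nat.le_mul_self d
    _ ≤ _ := Nat.mul_le_mul h1 h2

theorem DT_small (a b : ℕ) : PSmall (DT a b) := by
  intro d
  refine (Finset.range (a+b+d)).finite_toSet.subset ?_
  intro j hj
  by_contra h
  exact hj (DT_dvd _ _ _ _ (by simpa using h))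

theorem PT_refl (a b A n : ℕ) (h : n ≤ A + a + b) :
    DT a b n * iq (A + a + b - n) = PT (A + b) (A + a) (A + a + b - n) := by
  obtain ⟨j, hj⟩ := Nat.exists_eq_add_of_le h
  have e : A + a + b - n = j := by omega
  rw [e]
  have h1 : A + b - j = n - a := by omega
  have h2 : A + a - j = n - b := by omega
  have h3 : rq (A + b) j = rq n a := by
    unfold rq; rw [h1]; congr 1; simp; omega
  have h4 : rq (A + a) j = rq n b := by
    unfold rq; rw [h2]; congr 1; simp; omega
  rw [PT, DT, h1, h2, h3, h4]; ring

theorem DT_hasSum (a b : ℕ) : HasSum (DT a b) iinf := by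
  obtain ⟨G, hG⟩ := (DT_small a b).summable
  suffices G = iinf by rwa [← this]
  have key : ∀ d : ℕ, (X : PowerSeries ℚ) ^ d ∣ G * iinf - iinf * iinf := by
    intro d
    obtain ⟨A, hA⟩ : ∃ A, A = d + d := ⟨_, rfl⟩
    have s1 := hG.mul_right iinf
    have s2 : HasSum (fun n => DT a b n * rq (A + a + b) n) (iq (A + b) * iq (A + a)) := by
      have : iq (A + b) * iq (A + a) =
          ∑ n ∈ Finset.range (A + a + b + 1), DT a b n * rq (A + a + b) n := by
        rw [← pentagon, ← Finset.sum_range_reflect]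
        have e1 : ∀ n ∈ Finset.range (A + a + b + 1), DT a b n * rq (A + a + b) n =
            PT (A + b) (A + a) (A + a + b + 1 - 1 - n) := by
          intro n hn
          have hn' : n ≤ A + a + b := by simpa [Nat.lt_succ_iff] using hn
          rw [Nat.add_sub_cancel, ← PT_refl a b A n hn']
          simp [rq, hn']
        rw [Finset.sum_congr rfl e1, Finset.sum_range_reflect, Finset.sum_range_reflect]
        apply Finset.sum_subset
        · intro j; simp; omega
        · intro j _ hj
          exact PT_lt_left (by simpa using hj)
      rw [this]
      apply hasSum_sum_of_ne_finset_zero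
      intro n hn
      rw [rq_lt (by simpa using hn), mul_zero]
    have s3 := s1.sub s2
    have h3 := dvd_of_hasSum (d := d) s3 (by
      intro n
      rw [← mul_sub]
      rcases Nat.lt_or_ge n (a + b + d) with hn | hn
      · apply Dvd.dvd.mul_left
        rw [rq, if_pos (by omega)]
        rw [dvd_sub_comm]
        exact iinf_cong _ _ (by omega)
      · exact Dvd.dvd.mul_right (DT_dvd _ _ _ _ hn) _)
    have c1 := iinf_cong d (A + b) (by omega)
    have c2 := iinf_cong d (A + a) (by omega)
    have : G * iinf - iinf * iinf = (G * iinf - iq (A+b) * iq (A+a)) +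
      ((iq (A+b) - iinf) * iq (A + a) + (iq (A+a) - iinf) * iinf) := by ring
    rw [this]
    exact dvd_add h3 (dvd_add (Dvd.dvd.mul_right c1 _) (Dvd.dvd.mul_right c2 _))
  have := eq_of_dvd key
  linear_combination qpXInf * this - (G - iinf) * qinf_mul_iinf

def QZ {N : ℕ} (n : Fin (N+1) → ℕ) : ℤ :=
  (∑ i, (n i : ℤ) ^ 2) - ∑ i : Fin N, (n i.castSucc : ℤ) * (n i.succ : ℤ)

theorem two_QZ {N : ℕ} (n : Fin (N+1) → ℕ) : 2 * QZ n = (n 0 : ℤ) ^ 2 + (n (Fin.last N) : ℤ) ^ 2 +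
    ∑ i : Fin N, ((n i.castSucc : ℤ) - n i.succ) ^ 2 := by
  have h1 := Fin.sum_univ_succ (fun i => (n i : ℤ) ^ 2)
  have h2 := Fin.sum_univ_castSucc (fun i => (n i : ℤ) ^ 2)
  have h3 : ∑ i : Fin N, ((n i.castSucc : ℤ) - n i.succ) ^ 2 =
      ∑ i : Fin N, (n i.castSucc : ℤ) ^ 2 + ∑ i : Fin N, (n i.succ : ℤ) ^ 2
        - 2 * ∑ i : Fin N, (n i.castSucc : ℤ) * n i.succ := by
    rw [Finset.mul_sum, ← Finset.sum_add_distrib, ← Finset.sum_sub_distrib]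
    exact Finset.sum_congr rfl fun i _ => by ring
  rw [h3, QZ]
  linarith

theorem bound_aux {N : ℕ} (n : Fin (N+1) → ℤ) (i : Fin (N+1)) :
    n i ≤ n 0 + ∑ i : Fin N, (n i.castSucc - n i.succ) ^ 2 := by
  induction N with
  | zero => rw [Fin.fin_one_eq_zero i]; simp
  | succ N ih =>
    refine Fin.cases ?_ (fun k => ?_) i
    · have : 0 ≤ ∑ i : Fin (N+1), (n i.castSucc - n i.succ) ^ 2 :=
        Finset.sum_nonneg fun _ _ => sq_nonneg _
      linarith
    · have h := ih (fun i => n i.succ) k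
      rw [Fin.sum_univ_succ]
      simp only [Fin.castSucc_zero, ← Fin.succ_castSucc]
      have h2 : n (Fin.succ 0) - n 0 ≤ (n 0 - n (Fin.succ 0)) ^ 2 := by
        have := Int.le_self_sq (n (Fin.succ 0) - n 0)
        linarith [sq_nonneg (n 0), show (n (Fin.succ 0) - n 0)^2 = (n 0 - n (Fin.succ 0)) ^ 2 by ring]
      linarith

theorem QZ_bound {N : ℕ} (n : Fin (N+1) → ℕ) (i : Fin (N+1)) : (n i : ℤ) ≤ 2 * QZ n := by
  have h := bound_aux (fun i => (n i : ℤ)) i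
  have h2 := two_QZ n
  have h3 := Int.le_self_sq (n 0 : ℤ)
  have h4 := sq_nonneg (n (Fin.last N) : ℤ)
  linarith

theorem QZ_nonneg {N : ℕ} (n : Fin (N+1) → ℕ) : 0 ≤ QZ n := by
  have := QZ_bound n 0
  omega

noncomputable def TT {N : ℕ} (n : Fin (N+2) → ℕ) (j : Fin (N+1) → ℕ) : PowerSeries ℚ :=
  X ^ (QZ n).toNat * (iq (n 0) * iq (n (Fin.last _))) *
    ∏ i : Fin (N+1), PT (n i.castSucc) (n i.succ) (j i)

theorem TT_small (N : ℕ) :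
    PSmall (fun p : (Fin (N+2) → ℕ) × (Fin (N+1) → ℕ) => TT p.1 p.2) := by
  intro d
  refine ((Set.Finite.pi (t := fun _ : Fin (N+2) => Set.Iic (2*d)) (fun i => Set.finite_Iic _)).prod
    (Set.Finite.pi (t := fun _ : Fin (N+1) => Set.Iic (2*d)) (fun i => Set.finite_Iic _))).subset ?_
  rintro ⟨n, j⟩ h
  simp only [Set.mem_ofPred_eq] at h
  have hQ : (QZ n).toNat < d := by
    by_contra hd
    apply h
    rw [TT, mul_assoc]
    exact Dvd.dvd.mul_right (pow_dvd_pow _ (by omega)) _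
  have hn : ∀ i, n i ≤ 2 * d := by
    intro i
    have h1 := QZ_bound n i
    have h2 := QZ_nonneg n
    omega
  have hj : ∀ i, j i ≤ n i.castSucc := by
    intro i
    by_contra hi
    apply h
    have : ∏ i : Fin (N+1), PT (n i.castSucc) (n i.succ) (j i) = 0 :=
      Finset.prod_eq_zero (Finset.mem_univ i) (PT_lt_left (by omega))
    rw [TT, this, mul_zero]
    exact dvd_zero _
  refine ⟨fun i _ => hn i, fun i _ => (hj i).trans (hn _)⟩

abbrev jl {N : ℕ} (j : Fin (N+1) → ℕ) : Fin (N+2) → ℕ := Fin.cons 0 j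
abbrev jr {N : ℕ} (j : Fin (N+1) → ℕ) : Fin (N+2) → ℕ := Fin.snoc j 0

theorem exp_eq {N : ℕ} (n : Fin (N+2) → ℕ) (j : Fin (N+1) → ℕ)
    (h : ∀ i, j i ≤ n i.castSucc ∧ j i ≤ n i.succ) :
    (QZ n).toNat + ∑ i : Fin (N+1), (n i.castSucc - j i) * (n i.succ - j i) =
    (QZ j).toNat + ∑ i : Fin (N+2), (n i - jl j i) * (n i - jr j i) := by
  have hl : ∀ i, jl j i ≤ n i := by
    intro i
    refine Fin.cases ?_ (fun k => ?_) i
    · simp [jl]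
    · simpa [jl] using (h k).2
  have hr : ∀ i, jr j i ≤ n i := by
    intro i
    refine Fin.lastCases ?_ (fun k => ?_) i
    · simp [jr]
    · simpa [jr] using (h k).1
  zify
  rw [Int.toNat_of_nonneg (QZ_nonneg n), Int.toNat_of_nonneg (QZ_nonneg j)]
  have e1 : ∑ i : Fin (N+1), (((n i.castSucc - j i : ℕ) : ℤ) * ((n i.succ - j i : ℕ) : ℤ)) =
      ∑ i : Fin (N+1), (n i.castSucc : ℤ) * n i.succ - ∑ i : Fin (N+1), (n i.castSucc : ℤ) * j i
      - ∑ i : Fin (N+1), (n i.succ : ℤ) * j i + ∑ i : Fin (N+1), (j i : ℤ) ^ 2 := by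
    rw [← Finset.sum_sub_distrib, ← Finset.sum_sub_distrib, ← Finset.sum_add_distrib]
    refine Finset.sum_congr rfl fun i _ => ?_
    rw [Nat.cast_sub (h i).1, Nat.cast_sub (h i).2]
    ring
  have e2 : ∑ i : Fin (N+2), (((n i - jl j i : ℕ) : ℤ) * ((n i - jr j i : ℕ) : ℤ)) =
      ∑ i : Fin (N+2), (n i : ℤ) ^ 2 - ∑ i : Fin (N+2), (n i : ℤ) * jr j i
      - ∑ i : Fin (N+2), (n i : ℤ) * jl j i + ∑ i : Fin (N+2), (jl j i : ℤ) * jr j i := by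
    rw [← Finset.sum_sub_distrib, ← Finset.sum_sub_distrib, ← Finset.sum_add_distrib]
    refine Finset.sum_congr rfl fun i _ => ?_
    rw [Nat.cast_sub (hl i), Nat.cast_sub (hr i)]
    ring
  have e3 : ∑ i : Fin (N+2), (n i : ℤ) * jr j i = ∑ i : Fin (N+1), (n i.castSucc : ℤ) * j i := by
    rw [Fin.sum_univ_castSucc]; simp [jr]
  have e4 : ∑ i : Fin (N+2), (n i : ℤ) * jl j i = ∑ i : Fin (N+1), (n i.succ : ℤ) * j i := by
    rw [Fin.sum_univ_succ]; simp [jl]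
  have e5 : ∑ i : Fin (N+2), (jl j i : ℤ) * jr j i =
      ∑ i : Fin N, (j i.castSucc : ℤ) * j i.succ := by
    rw [Fin.sum_univ_succ, Fin.sum_univ_castSucc]
    have h0 : jl j 0 = 0 := by simp [jl]
    have h1 : jr j (Fin.last N).succ = 0 := by
      rw [Fin.succ_last]; simp [jr]
    rw [h0, h1]
    simp only [Nat.cast_zero, zero_mul, mul_zero, zero_add, add_zero]
    refine Finset.sum_congr rfl fun i _ => ?_
    have h2 : jr j i.castSucc.succ = j i.succ := by
      rw [Fin.succ_castSucc]; exact Fin.snoc_castSucc (α := fun _ => ℕ) _ _ _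
    have h3 : jl j i.castSucc.succ = j i.castSucc := Fin.cons_succ (α := fun _ => ℕ) _ _ _
    rw [h2, h3]
  push_cast
  rw [e1, e2, e3, e4, e5, QZ, QZ]
  ring

theorem TT_eq {N : ℕ} (n : Fin (N+2) → ℕ) (j : Fin (N+1) → ℕ) :
    TT n j = X ^ (QZ j).toNat * (∏ i, iq (j i)) *
      ∏ i : Fin (N+2), DT (jl j i) (jr j i) (n i) := by
  have r0 : ∀ m, rq m 0 = iq m := fun m => by simp [rq]
  have a1 : ∏ i : Fin (N+2), rq (n i) (jl j i) =
      iq (n 0) * ∏ i : Fin (N+1), rq (n i.succ) (j i) := by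
    rw [Fin.prod_univ_succ]; simp [jl, r0]
  have a2 : ∏ i : Fin (N+2), rq (n i) (jr j i) =
      (∏ i : Fin (N+1), rq (n i.castSucc) (j i)) * iq (n (Fin.last _)) := by
    rw [Fin.prod_univ_castSucc]; simp [jr, r0]
  simp only [TT, PT, DT, Finset.prod_mul_distrib, Finset.prod_pow_eq_pow_sum, a1, a2]
  by_cases h : ∀ i, j i ≤ n i.castSucc ∧ j i ≤ n i.succ
  · have e := exp_eq n j h
    have e' : (X : PowerSeries ℚ) ^ (QZ n).toNat *
        X ^ (∑ i : Fin (N+1), (n i.castSucc - j i) * (n i.succ - j i)) =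
        X ^ (QZ j).toNat * X ^ (∑ i : Fin (N+2), (n i - jl j i) * (n i - jr j i)) := by
      rw [← pow_add, ← pow_add, e]
    linear_combination (iq (n 0) * iq (n (Fin.last _)) * (∏ i, iq (j i)) *
      (∏ i : Fin (N+1), rq (n i.castSucc) (j i)) * ∏ i : Fin (N+1), rq (n i.succ) (j i)) * e'
  · push Not at h
    obtain ⟨i, hi⟩ := h
    rcases Nat.lt_or_ge (n i.castSucc) (j i) with h1 | h1
    · have : ∏ i : Fin (N+1), rq (n i.castSucc) (j i) = 0 :=
        Finset.prod_eq_zero (Finset.mem_univ i) (rq_lt h1)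
      simp [this]
    · have : ∏ i : Fin (N+1), rq (n i.succ) (j i) = 0 :=
        Finset.prod_eq_zero (Finset.mem_univ i) (rq_lt (hi h1))
      simp [this]

theorem main_general (N : ℕ) :
    ∑' n : Fin (N+2) → ℕ, (X : PowerSeries ℚ) ^ (QZ n).toNat * (∏ i, qpX (n i) ^ 2)⁻¹ =
    (qpXInf ^ (N+2))⁻¹ *
      ∑' n : Fin (N+1) → ℕ, (X : PowerSeries ℚ) ^ (QZ n).toNat * (∏ i, qpX (n i))⁻¹ := by
  obtain ⟨S, hS⟩ := (TT_small N).summable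
  have h1 : HasSum (fun n : Fin (N+2) → ℕ =>
      (X : PowerSeries ℚ) ^ (QZ n).toNat * (∏ i, qpX (n i) ^ 2)⁻¹) S := by
    refine HasSum.prod_fiberwise hS (fun n => ?_)
    have := (hasSum_pi (fun i : Fin (N+1) => PT_small (n i.castSucc) (n i.succ))
      (fun i => PT_hasSum (n i.castSucc) (n i.succ))).mul_left
        (X ^ (QZ n).toNat * (iq (n 0) * iq (n (Fin.last _))))
    convert! this using 1
    rw [iq_prod]
    simp only [iq_pow]
    change _ * ∏ i, iq (n i) ^ 2 = _
    have p1 := Fin.prod_univ_succ (fun i => iq (n i))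
    have p2 := Fin.prod_univ_castSucc (fun i => iq (n i))
    rw [Finset.prod_pow, Finset.prod_mul_distrib, sq]
    nth_rw 1 [p1]
    rw [p2]
    ring
  have h2 : HasSum (fun j : Fin (N+1) → ℕ =>
      (X : PowerSeries ℚ) ^ (QZ j).toNat * (∏ i, iq (j i)) * iinf ^ (N+2)) S := by
    have hS' := (Equiv.prodComm (Fin (N+1) → ℕ) (Fin (N+2) → ℕ)).hasSum_iff.2 hS
    refine HasSum.prod_fiberwise hS' (fun j => ?_)
    have := (hasSum_pi (fun i : Fin (N+2) => DT_small (jl j i) (jr j i))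
      (fun i => DT_hasSum (jl j i) (jr j i))).mul_left (X ^ (QZ j).toNat * (∏ i, iq (j i)))
    convert! this using 1
    · funext n
      exact TT_eq n j
    · simp
  have h3 := h2.mul_right (qpXInf ^ (N+2))
  have hu : iinf ^ (N+2) * qpXInf ^ (N+2) = 1 := by
    rw [← mul_pow, mul_comm, qinf_mul_iinf, one_pow]
  have h4 : HasSum (fun n : Fin (N+1) → ℕ =>
      (X : PowerSeries ℚ) ^ (QZ n).toNat * (∏ i, qpX (n i))⁻¹) (S * qpXInf ^ (N+2)) := by
    convert! h3 using 1
    funext n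
    rw [iq_prod, mul_assoc _ (iinf ^ (N+2)), hu, mul_one]
    rfl
  rw [h1.tsum_eq, h4.tsum_eq, iq_pow]
  change S = iinf ^ (N+2) * _
  linear_combination (-S) * hu

theorem stmt18 (k : ℕ) (hk : 1 ≤ k) :
    ∑' n : Fin (2 * k) → ℕ,
        (X : PowerSeries ℚ) ^
            ((∑ i, (n i : ℤ) ^ 2) -
              ∑ i : Fin (2 * k - 1),
                (n ⟨i.1, by have := i.isLt; omega⟩ : ℤ) *
                  (n ⟨i.1 + 1, by have := i.isLt; omega⟩ : ℤ)).toNat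
          * (∏ i, qpX (n i) ^ 2)⁻¹
      = (qpXInf ^ (2 * k))⁻¹ *
          ∑' n : Fin (2 * k - 1) → ℕ,
            (X : PowerSeries ℚ) ^
                ((∑ i, (n i : ℤ) ^ 2) -
                  ∑ i : Fin (2 * k - 2),
                    (n ⟨i.1, by have := i.isLt; omega⟩ : ℤ) *
                      (n ⟨i.1 + 1, by have := i.isLt; omega⟩ : ℤ)).toNat
              * (∏ i, qpX (n i))⁻¹ := by

  obtain ⟨m, rfl⟩ : ∃ m, k = m + 1 := ⟨k - 1, by omega⟩
  exact main_general (2 * m)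
end

section
/- For any integer k ≥ 2 and |q|<1, ∑_{n₁,…,n_k≥0} q^{n₁n₂+n₂n₃+⋯+n_{k-1}n_k + n₁+⋯+n_k} (−q^{1/2};q)_{n₁} / ∏_{i=1}^k (q;q)_{n_i}² equals (−q^{1/2};q)_∞/(q;q)_∞^{k+1} times the false/partial theta series ( ∑_{n≥0} + (−1)^k ∑_{n<0} ) (−1)^{(k+1)n} q^{((k+2)n²+(k+1)n)/2}. -/
/-- The finite q-Pochhammer symbol `(q;q)_n`. -/
noncomputable def qPoch (q : ℂ) (n : ℕ) : ℂ := ∏ i ∈ Finset.range n, (1 - q ^ (i + 1))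

/-- The infinite q-Pochhammer symbol `(q;q)_∞`. -/
noncomputable def qPochInf (q : ℂ) : ℂ := ∏' i : ℕ, (1 - q ^ (i + 1))

/-- The infinite q-Pochhammer symbol `(a;q)_∞ = ∏_{i≥0} (1 - a q^i)`. -/
noncomputable def pochInf (a q : ℂ) : ℂ := ∏' i : ℕ, (1 - a * q ^ i)


open Finset Filter Topology

namespace S19

theorem qP_zero (q : ℂ) : qPoch q 0 = 1 := by simp [qPoch]

theorem qP_succ (q : ℂ) (n : ℕ) : qPoch q (n + 1) = qPoch q n * (1 - q ^ (n + 1)) := by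
  simp [qPoch, Finset.prod_range_succ]

theorem one_sub_ne {x : ℂ} (hx : ‖x‖ < 1) : 1 - x ≠ 0 := by
  intro h
  have : x = 1 := by linear_combination -h
  rw [this] at hx; simp at hx

theorem one_add_ne {x : ℂ} (hx : ‖x‖ < 1) : 1 + x ≠ 0 := by
  have := one_sub_ne (x := -x) (by simpa using hx)
  simpa using this

theorem pow_lt {q : ℂ} (hq : ‖q‖ < 1) (n : ℕ) : ‖q ^ (n + 1)‖ < 1 := by
  rw [norm_pow]; exact pow_lt_one₀ (norm_nonneg _) hq (by omega)

theorem fac_ne {q : ℂ} (hq : ‖q‖ < 1) (n : ℕ) : 1 - q ^ (n + 1) ≠ 0 := one_sub_ne (pow_lt hq n)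

theorem qP_ne {q : ℂ} (hq : ‖q‖ < 1) (n : ℕ) : qPoch q n ≠ 0 := by
  unfold qPoch
  exact Finset.prod_ne_zero_iff.2 fun i _ => fac_ne hq i

/-- `∏_{i<n} (1 + s q^i)` -/
noncomputable def EE (s q : ℂ) (n : ℕ) : ℂ := ∏ i ∈ range n, (1 + s * q ^ i)

theorem EE_succ (s q : ℂ) (n : ℕ) : EE s q (n + 1) = EE s q n * (1 + s * q ^ n) := by
  simp [EE, Finset.prod_range_succ]

noncomputable def lam (s : ℂ) (n : ℕ) : ℂ := (-1) ^ n * s ^ (n * (n + 1))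

theorem lam_zero (s : ℂ) : lam s 0 = 1 := by simp [lam]

theorem lam_succ (s : ℂ) (n : ℕ) : lam s (n + 1) = - (s ^ 2) ^ (n + 1) * lam s n := by
  simp only [lam]; ring

theorem lam_add (s : ℂ) (r u : ℕ) :
    lam s (r + u) = lam s r * lam s u * (s ^ 2) ^ (u * r) := by
  simp only [lam]; ring

/-- Pascal step. -/
theorem pascal {q : ℂ} (hq : ‖q‖ < 1) (N : ℕ) (f : ℕ → ℂ) :
    (1 - q ^ (N + 1)) * ∑ p ∈ antidiagonal (N + 1), f p.1 / (qPoch q p.1 * qPoch q p.2)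
      = ∑ p ∈ antidiagonal N, (f p.1 + q ^ p.2 * f (p.1 + 1)) / (qPoch q p.1 * qPoch q p.2) := by
  have h1 : (1 - q ^ (N + 1)) * ∑ p ∈ antidiagonal (N + 1), f p.1 / (qPoch q p.1 * qPoch q p.2)
      = ∑ p ∈ antidiagonal (N + 1), (1 - q ^ p.2) * f p.1 / (qPoch q p.1 * qPoch q p.2)
      + ∑ p ∈ antidiagonal (N + 1),
          q ^ p.2 * (1 - q ^ p.1) * f p.1 / (qPoch q p.1 * qPoch q p.2) := by
    rw [← Finset.sum_add_distrib, Finset.mul_sum]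
    refine Finset.sum_congr rfl fun p hp => ?_
    rw [← HasAntidiagonal.mem_antidiagonal.1 hp]
    ring
  rw [h1, Finset.Nat.sum_antidiagonal_succ', Finset.Nat.sum_antidiagonal_succ]
  simp only [pow_zero, sub_self, zero_mul, mul_zero, zero_div, zero_add]
  rw [← Finset.sum_add_distrib]
  refine Finset.sum_congr rfl fun p hp => ?_
  have a1 := qP_ne hq p.1
  have a2 := qP_ne hq p.2
  have a3 := fac_ne hq p.1
  have a4 := fac_ne hq p.2
  rw [qP_succ, qP_succ]
  field_simp
  

theorem pascal2 {q s : ℂ} (hs : s ^ 2 = q) (hq : ‖q‖ < 1) (N r : ℕ) (g : ℕ → ℂ) :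
    (1 - q ^ (N + 1)) *
      ∑ p ∈ antidiagonal (N + 1), lam s p.1 * q ^ (p.1 * r) * g p.1 / (qPoch q p.1 * qPoch q p.2)
      = ∑ p ∈ antidiagonal N, lam s p.1 * q ^ (p.1 * r) * g p.1 / (qPoch q p.1 * qPoch q p.2)
       - q ^ (N + r + 1) * ∑ p ∈ antidiagonal N,
          lam s p.1 * q ^ (p.1 * r) * g (p.1 + 1) / (qPoch q p.1 * qPoch q p.2) := by
  rw [pascal hq N (fun i => lam s i * q ^ (i * r) * g i), Finset.mul_sum,
    ← Finset.sum_sub_distrib]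
  refine Finset.sum_congr rfl fun p hp => ?_
  rw [← HasAntidiagonal.mem_antidiagonal.1 hp, lam_succ, hs]
  ring

theorem qbin {q s : ℂ} (hs : s ^ 2 = q) (hq : ‖q‖ < 1) (r N : ℕ) :
    ∑ p ∈ antidiagonal N, lam s p.1 * q ^ (p.1 * r) / (qPoch q p.1 * qPoch q p.2)
      = qPoch q (r + N) / (qPoch q r * qPoch q N) := by
  induction N with
  | zero => simp [qP_zero, lam_zero, qP_ne hq r]
  | succ N ih =>
    have h := pascal2 hs hq N r (fun _ => 1)
    simp only [mul_one] at h
    rw [ih] at h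
    have a3 := fac_ne hq N
    apply mul_left_cancel₀ a3
    rw [h, qP_succ, ← add_assoc, qP_succ]
    have a1 := qP_ne hq r
    have a2 := qP_ne hq N
    field_simp
    ring

theorem chu {q s : ℂ} (hs : s ^ 2 = q) (hq : ‖q‖ < 1) (r N : ℕ) : ∀ p : ℕ,
    ∑ x ∈ antidiagonal N, lam s x.1 * q ^ (x.1 * r) *
        (qPoch q (p + x.1) / qPoch q (p + r + 1 + x.1)) / (qPoch q x.1 * qPoch q x.2)
      = qPoch q (r + N) * qPoch q p / (qPoch q r * qPoch q N * qPoch q (p + r + 1 + N)) := by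
  induction N with
  | zero => intro p; simp [qP_zero, lam_zero]; field_simp [qP_ne hq r]
  | succ N ih =>
    intro p
    have h := pascal2 hs hq N r (fun i => qPoch q (p + i) / qPoch q (p + r + 1 + i))
    have e : ∀ i, qPoch q (p + (i + 1)) / qPoch q (p + r + 1 + (i + 1))
      = qPoch q (p + 1 + i) / qPoch q (p + 1 + r + 1 + i) := by
      intro i
      rw [show p + (i + 1) = p + 1 + i by ring, show p + r + 1 + (i + 1) = p + 1 + r + 1 + i by ring]
    simp only [e] at h
    rw [ih p, ih (p + 1)] at h
    have a3 := fac_ne hq N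
    apply mul_left_cancel₀ a3
    rw [h, qP_succ q N, ← add_assoc, qP_succ q (r + N), ← add_assoc, qP_succ q (p + r + 1 + N),
      show p + 1 + r + 1 + N = (p + r + 1 + N) + 1 by ring, qP_succ q (p + r + 1 + N), qP_succ q p]
    have a1 := qP_ne hq r
    have a2 := qP_ne hq N
    have a4 := qP_ne hq (p + r + 1 + N)
    have a5 := fac_ne hq (p + r + 1 + N)
    field_simp
    ring

theorem bailey_step {q s : ℂ} (hs : s ^ 2 = q) (hq : ‖q‖ < 1) (r w : ℕ) :
    ∑ x ∈ antidiagonal w, lam s (r + x.1) * qPoch q (r + x.1) /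
        (qPoch q x.1 * qPoch q x.2 * qPoch q (r + x.1 + r + 1))
      = lam s r * qPoch q (r + w) / (qPoch q w * qPoch q (r + w + r + 1)) := by
  have h := chu hs hq r w r
  have : ∀ x ∈ antidiagonal w, lam s (r + x.1) * qPoch q (r + x.1) /
        (qPoch q x.1 * qPoch q x.2 * qPoch q (r + x.1 + r + 1)) =
      lam s r * (lam s x.1 * q ^ (x.1 * r) *
        (qPoch q (r + x.1) / qPoch q (r + r + 1 + x.1)) / (qPoch q x.1 * qPoch q x.2)) := by
    intro x _
    rw [lam_add, hs, show r + x.1 + r + 1 = r + r + 1 + x.1 by ring]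
    have a1 := qP_ne hq x.1
    have a2 := qP_ne hq x.2
    have a4 := qP_ne hq (r + r + 1 + x.1)
    field_simp
  rw [Finset.sum_congr rfl this, ← Finset.mul_sum, h, show r + w + r + 1 = r + r + 1 + w by ring]
  have a1 := qP_ne hq r
  have a2 := qP_ne hq w
  have a4 := qP_ne hq (r + r + 1 + w)
  field_simp

theorem triple (j : ℕ) (F : ℕ → ℕ → ℕ → ℂ) :
    ∑ x ∈ antidiagonal j, ∑ y ∈ antidiagonal x.1, F y.1 y.2 x.2
      = ∑ x ∈ antidiagonal j, ∑ y ∈ antidiagonal x.2, F x.1 y.1 y.2 := by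
  rw [Finset.sum_sigma', Finset.sum_sigma']
  refine Finset.sum_bij' (fun z _ => ⟨(z.2.1, z.2.2 + z.1.2), (z.2.2, z.1.2)⟩)
    (fun z _ => ⟨(z.1.1 + z.2.1, z.2.2), (z.1.1, z.2.1)⟩) ?_ ?_ ?_ ?_ ?_
  · rintro ⟨⟨a, b⟩, ⟨c, d⟩⟩ h
    simp only [mem_sigma, HasAntidiagonal.mem_antidiagonal] at h ⊢
    obtain ⟨h1, h2⟩ := h
    subst h2; subst h1
    exact ⟨by simp [add_assoc], trivial⟩
  · rintro ⟨⟨a, b⟩, ⟨c, d⟩⟩ h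
    simp only [mem_sigma, HasAntidiagonal.mem_antidiagonal] at h ⊢
    obtain ⟨h1, h2⟩ := h
    subst h2; subst h1
    exact ⟨by simp [add_assoc], trivial⟩
  · rintro ⟨⟨a, b⟩, ⟨c, d⟩⟩ h
    simp only [mem_sigma, HasAntidiagonal.mem_antidiagonal] at h ⊢
    obtain ⟨h1, h2⟩ := h
    subst h2; rfl
  · rintro ⟨⟨a, b⟩, ⟨c, d⟩⟩ h
    simp only [mem_sigma, HasAntidiagonal.mem_antidiagonal] at h ⊢
    obtain ⟨h1, h2⟩ := h
    subst h2; rfl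
  · rintro ⟨⟨a, b⟩, ⟨c, d⟩⟩ h
    rfl

/-- Bailey transform of a sequence. -/
noncomputable def BT (q : ℂ) (c : ℕ → ℂ) (j : ℕ) : ℂ :=
  ∑ x ∈ antidiagonal j, c x.1 * qPoch q j ^ 2 / (qPoch q x.2 * qPoch q (j + x.1 + 1))

theorem BT_step {q s : ℂ} (hs : s ^ 2 = q) (hq : ‖q‖ < 1) (c : ℕ → ℂ) (j : ℕ) :
    ∑ x ∈ antidiagonal j, qPoch q j * lam s x.1 / (qPoch q x.1 * qPoch q x.2) * BT q c x.1
      = BT q (fun r => lam s r * c r) j := by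
  have h1 : ∀ x ∈ antidiagonal j,
      qPoch q j * lam s x.1 / (qPoch q x.1 * qPoch q x.2) * BT q c x.1
      = ∑ y ∈ antidiagonal x.1, (fun r u l => qPoch q j * c r * (lam s (r + u) * qPoch q (r + u) /
        (qPoch q u * qPoch q l * qPoch q (r + u + r + 1)))) y.1 y.2 x.2 := by
    intro x _
    rw [BT, Finset.mul_sum]
    refine Finset.sum_congr rfl fun y hy => ?_
    simp only [HasAntidiagonal.mem_antidiagonal.1 hy]
    have a1 := qP_ne hq x.1
    have a2 := qP_ne hq x.2
    have a3 := qP_ne hq y.2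
    have a4 := qP_ne hq (x.1 + y.1 + 1)
    field_simp
  rw [Finset.sum_congr rfl h1, triple j (fun r u l => qPoch q j * c r *
    (lam s (r + u) * qPoch q (r + u) /
        (qPoch q u * qPoch q l * qPoch q (r + u + r + 1)))), BT]
  refine Finset.sum_congr rfl fun x hx => ?_
  rw [← Finset.mul_sum, bailey_step hs hq, HasAntidiagonal.mem_antidiagonal.1 hx]
  ring

noncomputable def al (s : ℂ) (r : ℕ) : ℂ := (-1) ^ r * s ^ (2 * r ^ 2 + r) * (1 - s ^ (2 * r + 1))

theorem seed_tel {q s : ℂ} (hs : s ^ 2 = q) (hq : ‖q‖ < 1) (M d : ℕ) :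
    ∑ r ∈ range (M + 1), ((1 - q ^ (M + d + 1)) * (1 + s * q ^ (M + d + 1)) *
        (al s r / (qPoch q (M + d + 1 - r) * qPoch q (M + d + 1 + r + 1)))
        - al s r / (qPoch q (M + d - r) * qPoch q (M + d + r + 1)))
      = (-1) ^ (M + 1) * q ^ (M + d + 1) * s ^ (2 * M ^ 2 + 3 * M + 1) * (s ^ (2 * M + 2) - 1)
        / (qPoch q d * qPoch q (M + d + 1 + M + 1)) := by
  induction M generalizing d with
  | zero =>
    simp only [zero_add, range_one, sum_singleton, al, pow_zero, Nat.sub_zero, add_zero, mul_zero]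
    rw [qP_succ q (d + 1), qP_succ q d]
    have a1 := qP_ne hq d
    have a2 := fac_ne hq d
    have a3 := fac_ne hq (d + 1)
    field_simp
    subst hs
    ring
  | succ M ih =>
    rw [Finset.sum_range_succ]
    have h := ih (d + 1)
    rw [show M + (d + 1) = M + 1 + d by ring] at h
    rw [h]
    rw [show M + 1 + d + 1 - (M + 1) = d + 1 by omega, show M + 1 + d - (M + 1) = d by omega,
      show M + 1 + d + 1 + (M + 1) + 1 = (2 * M + d + 3) + 1 by ring,
      show M + 1 + d + (M + 1) + 1 = 2 * M + d + 3 by ring,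
      show M + 1 + d + 1 + M + 1 = 2 * M + d + 3 by ring, qP_succ q (2 * M + d + 3), qP_succ q d]
    have a1 := qP_ne hq d
    have a2 := fac_ne hq d
    have a4 := qP_ne hq (2 * M + d + 3)
    have a3 := fac_ne hq (2 * M + d + 3)
    simp only [al]
    field_simp
    subst hs
    ring

theorem seed {q s : ℂ} (hs : s ^ 2 = q) (hq : ‖q‖ < 1) (hE : ∀ n, 1 + s * q ^ n ≠ 0) (n : ℕ) :
    ∑ r ∈ range (n + 1), al s r / (qPoch q (n - r) * qPoch q (n + r + 1))
      = 1 / (qPoch q n * EE s q (n + 1)) := by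
  induction n with
  | zero =>
    have h0 := hE 0
    have h1 := fac_ne hq 0
    simp [al, qP_succ, qP_zero, EE] at h0 h1 ⊢
    subst hs
    field_simp
    ring
  | succ n ih =>
    have h := seed_tel hs hq n 0
    simp only [add_zero] at h
    rw [Finset.sum_sub_distrib, ih, ← Finset.mul_sum] at h
    rw [Finset.sum_range_succ]
    have hEn : EE s q (n + 1) ≠ 0 := Finset.prod_ne_zero_iff.2 fun i _ => hE i
    have a1 := qP_ne hq n
    have a2 := fac_ne hq n
    have a3 := hE (n + 1)
    have a4 := qP_ne hq (n + 1 + n + 1)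
    have a5 := fac_ne hq (n + 1 + n + 1)
    have key : (1 - q ^ (n + 1)) * (1 + s * q ^ (n + 1)) *
      (al s (n + 1) / (qPoch q (n + 1 - (n + 1)) * qPoch q (n + 1 + (n + 1) + 1))) =
      - ((-1) ^ (n + 1) * q ^ (n + 1) * s ^ (2 * n ^ 2 + 3 * n + 1) * (s ^ (2 * n + 2) - 1)
        / (qPoch q 0 * qPoch q (n + 1 + n + 1))) := by
      rw [Nat.sub_self, qP_zero, show n + 1 + (n + 1) + 1 = (n + 1 + n + 1) + 1 by ring,
        qP_succ q (n + 1 + n + 1), al]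
      field_simp
      subst hs
      ring
    apply mul_left_cancel₀ (mul_ne_zero a2 a3)
    rw [mul_add, key]
    have e : (1 - q ^ (n + 1)) * (1 + s * q ^ (n + 1)) * (1 / (qPoch q (n + 1) * EE s q (n + 1 + 1)))
      = 1 / (qPoch q n * EE s q (n + 1)) := by
      rw [qP_succ, EE_succ s q (n + 1)]
      generalize 1 + s * q ^ (n + 1) = A at a3 ⊢
      field_simp
    rw [e]
    linear_combination h

theorem seedBT {q s : ℂ} (hs : s ^ 2 = q) (hq : ‖q‖ < 1) (hE : ∀ n, 1 + s * q ^ n ≠ 0) (n : ℕ) :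
    BT q (al s) n = qPoch q n / EE s q (n + 1) := by
  have h := seed hs hq hE n
  rw [BT, Finset.Nat.sum_antidiagonal_eq_sum_range_succ_mk]
  have hEn : EE s q (n + 1) ≠ 0 := Finset.prod_ne_zero_iff.2 fun i _ => hE i
  have a1 := qP_ne hq n
  have : ∀ r ∈ range n.succ, al s r * qPoch q n ^ 2 / (qPoch q (n - r) * qPoch q (n + r + 1))
    = qPoch q n ^ 2 * (al s r / (qPoch q (n - r) * qPoch q (n + r + 1))) := by
    intro r _; ring
  simp only
  rw [Finset.sum_congr rfl this, ← Finset.mul_sum, h]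
  field_simp


theorem summ_geo {q : ℂ} (hq : ‖q‖ < 1) : Summable (fun n : ℕ => ‖q‖ ^ n) :=
  summable_geometric_of_lt_one (norm_nonneg _) hq

theorem mult_EE {q : ℂ} (hq : ‖q‖ < 1) (a : ℂ) : Multipliable (fun i : ℕ => 1 + a * q ^ i) := by
  apply multipliable_one_add_of_summable
  simpa [norm_mul, norm_pow] using (summ_geo hq).mul_left ‖a‖

theorem tend_EE {q : ℂ} (hq : ‖q‖ < 1) (a : ℂ) :
    Tendsto (EE a q) atTop (𝓝 (∏' i : ℕ, (1 + a * q ^ i))) :=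
  (mult_EE hq a).tendsto_prod_tprod_nat

theorem qPInf_eq (q : ℂ) : qPochInf q = ∏' i : ℕ, (1 + (-q) * q ^ i) := by
  unfold qPochInf; congr 1; ext i; ring

theorem qP_eq (q : ℂ) : qPoch q = EE (-q) q := by
  ext n; unfold qPoch EE; refine Finset.prod_congr rfl fun i _ => ?_; ring

theorem tend_qP {q : ℂ} (hq : ‖q‖ < 1) : Tendsto (qPoch q) atTop (𝓝 (qPochInf q)) := by
  rw [qPInf_eq, qP_eq]; exact tend_EE hq _

theorem qPInf_ne {q : ℂ} (hq : ‖q‖ < 1) : qPochInf q ≠ 0 := by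
  rw [qPInf_eq]
  apply tprod_one_add_ne_zero_of_summable
  · intro i
    have := fac_ne hq i
    intro h; apply this; rw [← h]; ring
  · simpa [norm_mul, norm_pow] using (summ_geo hq).mul_left ‖q‖

theorem bdd_of_tend {u : ℕ → ℂ} {x : ℂ} (h : Tendsto u atTop (𝓝 x)) :
    ∃ C, 0 ≤ C ∧ ∀ n, ‖u n‖ ≤ C := by
  obtain ⟨C, hC⟩ := (Metric.isBounded_range_of_tendsto u h).exists_norm_le
  exact ⟨C, (norm_nonneg _).trans (hC (u 0) ⟨0, rfl⟩), fun n => hC _ ⟨n, rfl⟩⟩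

theorem bdd_inv {q : ℂ} (hq : ‖q‖ < 1) : ∃ C, 0 ≤ C ∧ ∀ n, ‖(qPoch q n)⁻¹‖ ≤ C :=
  bdd_of_tend ((tend_qP hq).inv₀ (qPInf_ne hq))

theorem norm_bd {q : ℂ} (hq : ‖q‖ < 1) {g : ℕ → ℂ} {C : ℝ} (hg : ∀ n, ‖g n‖ ≤ C) (j n : ℕ) :
    ‖q ^ (n * (j + 1)) * g n‖ ≤ ‖q‖ ^ n * C := by
  rw [norm_mul, norm_pow]
  exact mul_le_mul (pow_le_pow_of_le_one (norm_nonneg _) hq.le (Nat.le_mul_of_pos_right n (by omega)))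
    (hg n) (norm_nonneg _) (by positivity)

theorem summ_bd {q : ℂ} (hq : ‖q‖ < 1) {g : ℕ → ℂ} {C : ℝ} (hg : ∀ n, ‖g n‖ ≤ C) (j : ℕ) :
    Summable (fun n => q ^ (n * (j + 1)) * g n) :=
  Summable.of_norm_bounded ((summ_geo hq).mul_right C) (norm_bd hq hg j)

theorem tannery {q : ℂ} (hq : ‖q‖ < 1) {g : ℕ → ℂ} {C : ℝ} (hg : ∀ n, ‖g n‖ ≤ C) :
    Tendsto (fun j : ℕ => ∑' n, q ^ (n * (j + 1)) * g n) atTop (𝓝 (g 0)) := by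
  have h : Tendsto (fun j : ℕ => ∑' n, q ^ (n * (j + 1)) * g n) atTop
      (𝓝 (∑' n, if n = 0 then g 0 else 0)) := by
    refine tendsto_tsum_of_dominated_convergence ((summ_geo hq).mul_right C) ?_
      (Eventually.of_forall fun j n => norm_bd hq hg j n)
    intro n
    by_cases hn : n = 0
    · subst hn; simp
    · simp only [hn, if_false]
      rw [show (0 : ℂ) = 0 * g n by simp]
      refine Tendsto.mul_const _ ?_
      simp_rw [pow_mul]
      have h1 : ‖q ^ n‖ < 1 := by
        rw [norm_pow]; exact pow_lt_one₀ (norm_nonneg _) hq hn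
      exact (tendsto_pow_atTop_nhds_zero_of_norm_lt_one h1).comp (tendsto_add_atTop_nat 1)
  simpa using h

theorem bdd_c {q : ℂ} (hq : ‖q‖ < 1) {g : ℕ → ℂ} {C : ℝ} (hg : ∀ n, ‖g n‖ ≤ C) :
    ∃ C', 0 ≤ C' ∧ ∀ n, ‖(qPoch q n)⁻¹ * g n‖ ≤ C' := by
  obtain ⟨A, hA, h⟩ := bdd_inv hq
  have hC : 0 ≤ C := (norm_nonneg _).trans (hg 0)
  refine ⟨A * C, by positivity, fun n => ?_⟩
  rw [norm_mul]
  exact mul_le_mul (h n) (hg n) (norm_nonneg _) hA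

theorem cauchy_rec {q : ℂ} (hq : ‖q‖ < 1) (a : ℂ) (j : ℕ) :
    (1 - q ^ (j + 1)) * (∑' n, q ^ (n * (j + 1)) * ((qPoch q n)⁻¹ * EE a q n)) =
    (1 + a * q ^ (j + 1)) * (∑' n, q ^ (n * (j + 1 + 1)) * ((qPoch q n)⁻¹ * EE a q n)) := by
  obtain ⟨C0, _, hC0⟩ := bdd_of_tend (tend_EE hq a)
  obtain ⟨C, _, hC⟩ := bdd_c hq hC0
  have s1 := summ_bd hq hC j
  have s2 := summ_bd hq hC (j + 1)
  have h1 := s1.tsum_sub s2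
  rw [(s1.sub s2).tsum_eq_zero_add] at h1
  have h2 : ∀ n : ℕ, q ^ ((n + 1) * (j + 1)) * ((qPoch q (n + 1))⁻¹ * EE a q (n + 1))
      - q ^ ((n + 1) * (j + 1 + 1)) * ((qPoch q (n + 1))⁻¹ * EE a q (n + 1))
      = q ^ (j + 1) * (q ^ (n * (j + 1)) * ((qPoch q n)⁻¹ * EE a q n))
       + a * q ^ (j + 1) * (q ^ (n * (j + 1 + 1)) * ((qPoch q n)⁻¹ * EE a q n)) := by
    intro n
    rw [qP_succ, EE_succ]
    have a1 := qP_ne hq n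
    have a2 := fac_ne hq n
    field_simp
    ring
  simp only [h2] at h1
  rw [(s1.mul_left _).tsum_add (s2.mul_left _), tsum_mul_left, tsum_mul_left] at h1
  simp only [zero_mul, pow_zero, sub_self, zero_add] at h1
  linear_combination -h1

theorem cauchy {q : ℂ} (hq : ‖q‖ < 1) (a : ℂ) (j : ℕ) :
    (∑' n, q ^ (n * (j + 1)) * ((qPoch q n)⁻¹ * EE a q n)) * EE a q (j + 1)
      = qPoch q j / qPochInf q * ∏' i : ℕ, (1 + a * q ^ i) := by
  set f : ℕ → ℂ := fun j => ∑' n, q ^ (n * (j + 1)) * ((qPoch q n)⁻¹ * EE a q n) with hf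
  obtain ⟨C0, _, hC0⟩ := bdd_of_tend (tend_EE hq a)
  obtain ⟨C, _, hC⟩ := bdd_c hq hC0
  have hlim : Tendsto f atTop (𝓝 1) := by
    have := tannery hq hC
    rw [show (qPoch q 0)⁻¹ * EE a q 0 = 1 by simp [qP_zero, EE]] at this
    exact this
  set u : ℕ → ℂ := fun j => f j * EE a q (j + 1) / qPoch q j with hu
  have hconst : ∀ j, u (j + 1) = u j := by
    intro j
    have h := cauchy_rec hq a j
    change (1 - q ^ (j + 1)) * f j = (1 + a * q ^ (j + 1)) * f (j + 1) at h
    simp only [hu]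
    rw [qP_succ, EE_succ a q (j + 1)]
    have a1 := qP_ne hq j
    have a2 := fac_ne hq j
    rw [div_eq_div_iff (mul_ne_zero a1 a2) a1]
    linear_combination (- EE a q (j + 1) * qPoch q j) * h
  have hc : ∀ j, u j = u 0 := by
    intro j; induction j with
    | zero => rfl
    | succ n ih => rw [hconst, ih]
  have hl : Tendsto u atTop (𝓝 (1 * (∏' i : ℕ, (1 + a * q ^ i)) / qPochInf q)) :=
    (hlim.mul ((tend_EE hq a).comp (tendsto_add_atTop_nat 1))).div (tend_qP hq) (qPInf_ne hq)
  have hl2 : Tendsto u atTop (𝓝 (u 0)) := by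
    rw [show u = fun _ => u 0 from funext hc]; exact tendsto_const_nhds
  have h3 := (hc j).trans (tendsto_nhds_unique hl2 hl)
  have a1 := qP_ne hq j
  have a2 := qPInf_ne hq
  simp only [hu] at h3
  change f j * _ = _
  rw [div_eq_iff a1] at h3
  rw [h3]; ring

theorem euler {q : ℂ} (hq : ‖q‖ < 1) (j : ℕ) :
    (∑' n, q ^ (n * (j + 1)) * (qPoch q n)⁻¹) = qPoch q j / qPochInf q := by
  have := cauchy hq 0 j
  simpa [EE] using this

noncomputable def PP (s q : ℂ) : ℕ → ℕ → ℂ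
  | 0, n => EE s q n
  | t + 1, m => ∑' n, q ^ (n * (m + 1)) * ((qPoch q n)⁻¹ ^ 2 * PP s q t n)

noncomputable def RR (s q : ℂ) (t j : ℕ) : ℂ :=
  ∑' n, q ^ (n * (j + 1)) * ((qPoch q n)⁻¹ * PP s q t n)

theorem bdd_c2 {q : ℂ} (hq : ‖q‖ < 1) {g : ℕ → ℂ} {C : ℝ} (hg : ∀ n, ‖g n‖ ≤ C) :
    ∃ C', 0 ≤ C' ∧ ∀ n, ‖(qPoch q n)⁻¹ ^ 2 * g n‖ ≤ C' := by
  obtain ⟨A, hA, h⟩ := bdd_c hq hg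
  obtain ⟨B, hB, h'⟩ := bdd_c hq h
  refine ⟨B, hB, fun n => ?_⟩
  rw [pow_two, mul_assoc]; exact h' n

theorem bdd_PP {q : ℂ} (hq : ‖q‖ < 1) (s : ℂ) (t : ℕ) : ∃ C, ∀ n, ‖PP s q t n‖ ≤ C := by
  induction t with
  | zero =>
    obtain ⟨C, _, h⟩ := bdd_of_tend (tend_EE hq s)
    exact ⟨C, h⟩
  | succ t ih =>
    obtain ⟨C, h⟩ := ih
    obtain ⟨B, hB, h'⟩ := bdd_c2 hq h
    refine ⟨∑' n, ‖q‖ ^ n * B, fun m => ?_⟩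
    exact tsum_of_norm_bounded ((summ_geo hq).mul_right B).hasSum (norm_bd hq h' m)

set_option maxHeartbeats 1000000 in
theorem RR_succ {q s : ℂ} (hs : s ^ 2 = q) (hq : ‖q‖ < 1) (t j : ℕ) :
    RR s q (t + 1) j = (qPochInf q)⁻¹ * ∑ x ∈ antidiagonal j,
      qPoch q j * lam s x.1 / (qPoch q x.1 * qPoch q x.2) * RR s q t x.1 := by
  obtain ⟨C, hC⟩ := bdd_PP hq s t
  obtain ⟨B, hB, hB'⟩ := bdd_c2 hq hC
  obtain ⟨B1, hB1, hB1'⟩ := bdd_c hq hC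
  obtain ⟨A, hA, hA'⟩ := bdd_inv hq
  have h1 : RR s q (t + 1) j = ∑' m, ∑' n, q ^ (m * (j + 1)) * (qPoch q m)⁻¹ *
      (q ^ (n * (m + 1)) * ((qPoch q n)⁻¹ ^ 2 * PP s q t n)) := by
    rw [RR]
    refine tsum_congr fun m => ?_
    rw [tsum_mul_left, PP, mul_assoc]
  have hsum : Summable (Function.uncurry fun m n : ℕ => q ^ (m * (j + 1)) * (qPoch q m)⁻¹ *
      (q ^ (n * (m + 1)) * ((qPoch q n)⁻¹ ^ 2 * PP s q t n))) := by
    have hg : Summable fun x : ℕ × ℕ => (‖q‖ ^ x.1 * A) * (‖q‖ ^ x.2 * B) :=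
      ((summ_geo hq).mul_right A).mul_of_nonneg ((summ_geo hq).mul_right B)
        (fun n => by positivity) (fun n => by positivity)
    refine Summable.of_norm_bounded hg ?_
    rintro ⟨m, n⟩
    simp only [Function.uncurry]
    rw [norm_mul]
    exact mul_le_mul (norm_bd hq hA' j m) (norm_bd hq hB' m n) (norm_nonneg _) (by positivity)
  rw [h1, ← hsum.tsum_comm]
  have h2 : ∀ n : ℕ, ∑' m, q ^ (m * (j + 1)) * (qPoch q m)⁻¹ *
      (q ^ (n * (m + 1)) * ((qPoch q n)⁻¹ ^ 2 * PP s q t n)) =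
      ∑ x ∈ antidiagonal j, (qPochInf q)⁻¹ *
        (qPoch q j * lam s x.1 / (qPoch q x.1 * qPoch q x.2)) *
        (q ^ (n * (x.1 + 1)) * ((qPoch q n)⁻¹ * PP s q t n)) := by
    intro n
    have e1 : ∀ m : ℕ, q ^ (m * (j + 1)) * (qPoch q m)⁻¹ *
      (q ^ (n * (m + 1)) * ((qPoch q n)⁻¹ ^ 2 * PP s q t n)) =
      (q ^ (m * (n + j + 1)) * (qPoch q m)⁻¹) * (q ^ n * ((qPoch q n)⁻¹ ^ 2 * PP s q t n)) := by
      intro m; ring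
    simp only [e1]
    rw [tsum_mul_right, euler hq]
    have e2 := qbin hs hq n j
    have a1 := qP_ne hq n
    have a2 := qP_ne hq j
    have a3 := qPInf_ne hq
    have e3 : qPoch q (n + j) = qPoch q n * qPoch q j *
      ∑ p ∈ antidiagonal j, lam s p.1 * q ^ (p.1 * n) / (qPoch q p.1 * qPoch q p.2) := by
      rw [e2]; field_simp
    rw [e3, Finset.mul_sum, Finset.sum_div, Finset.sum_mul]
    refine Finset.sum_congr rfl fun x _ => ?_
    have a4 := qP_ne hq x.1
    have a5 := qP_ne hq x.2
    field_simp
    ring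
  simp only [h2]
  rw [Summable.tsum_finsetSum (fun x _ => (summ_bd hq hB1' x.1).mul_left _), Finset.mul_sum]
  refine Finset.sum_congr rfl fun x _ => ?_
  rw [tsum_mul_left, RR]; ring

theorem RR_eq {q s : ℂ} (hs : s ^ 2 = q) (hq : ‖q‖ < 1) (hE : ∀ n, 1 + s * q ^ n ≠ 0) (t : ℕ) :
    ∀ j, RR s q t j = (∏' i : ℕ, (1 + s * q ^ i)) / qPochInf q ^ (t + 1) *
      BT q (fun r => lam s r ^ t * al s r) j := by
  induction t with
  | zero =>
    intro j
    have h := cauchy hq s j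
    have hEn : EE s q (j + 1) ≠ 0 := Finset.prod_ne_zero_iff.2 fun i _ => hE i
    simp only [pow_zero, one_mul]
    rw [show (fun r => al s r) = al s from rfl, seedBT hs hq hE, RR]
    simp only [PP]
    rw [← eq_div_iff hEn] at h
    rw [h]; ring
  | succ t ih =>
    intro j
    rw [RR_succ hs hq]
    have : (fun r => lam s r ^ (t + 1) * al s r)
      = fun r => lam s r * (fun r => lam s r ^ t * al s r) r := by
      funext r; simp only; ring
    rw [this, ← BT_step hs hq]
    simp only [ih]
    rw [Finset.mul_sum, Finset.mul_sum]
    refine Finset.sum_congr rfl fun x _ => ?_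
    rw [pow_succ _ (t + 1)]
    have a3 := qPInf_ne hq
    field_simp

theorem tend_BT {q : ℂ} (hq : ‖q‖ < 1) (c : ℕ → ℂ) (hc : Summable (fun r => ‖c r‖)) :
    Tendsto (BT q c) atTop (𝓝 (∑' r, c r)) := by
  obtain ⟨A, hA, hA'⟩ := bdd_inv hq
  obtain ⟨B, hB, hB'⟩ := bdd_of_tend (tend_qP hq)
  have h1 : BT q c = fun j => ∑' r, if r ≤ j then
      c r * qPoch q j ^ 2 / (qPoch q (j - r) * qPoch q (j + r + 1)) else 0 := by
    funext j
    rw [BT, Finset.Nat.sum_antidiagonal_eq_sum_range_succ_mk, tsum_eq_sum (s := range (j + 1))]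
    · refine Finset.sum_congr rfl fun r hr => ?_
      rw [if_pos (by simp at hr; omega)]
    · intro r hr
      rw [if_neg (by simp at hr; omega)]
  rw [h1]
  refine tendsto_tsum_of_dominated_convergence (hc.mul_right (B ^ 2 * (A * A))) ?_
    (Eventually.of_forall fun j r => ?_)
  · intro r
    have l1 : Tendsto (fun j => qPoch q (j - r)) atTop (𝓝 (qPochInf q)) :=
      (tend_qP hq).comp (tendsto_sub_atTop_nat r)
    have l2 : Tendsto (fun j => qPoch q (j + r + 1)) atTop (𝓝 (qPochInf q)) :=
      (tend_qP hq).comp (tendsto_add_atTop_nat (r + 1))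
    have a := qPInf_ne hq
    have l3 := ((tendsto_const_nhds (x := c r)).mul ((tend_qP hq).pow 2)).div (l1.mul l2)
      (mul_ne_zero a a)
    have e : c r * qPochInf q ^ 2 / (qPochInf q * qPochInf q) = c r := by field_simp
    rw [e] at l3
    refine l3.congr' ?_
    filter_upwards [eventually_ge_atTop r] with j hj
    rw [if_pos hj]; rfl
  · split_ifs
    · rw [div_eq_mul_inv, mul_inv, norm_mul, norm_mul, norm_mul, norm_pow, mul_assoc]
      have := hA' (j - r)
      have := hA' (j + r + 1)
      have := hB' j
      gcongr
    · rw [norm_zero]; positivity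


noncomputable def tm (s q : ℂ) (k : ℕ) (m : ℕ) (n : Fin (k + 1) → ℕ) : ℂ :=
  q ^ ((∑ i : Fin k, n i.castSucc * n i.succ) + ∑ i, n i + n (Fin.last k) * m) *
    EE s q (n 0) / ∏ i, qPoch q (n i) ^ 2

theorem tm_snoc (s q : ℂ) (k m : ℕ) (x : ℕ) (n : Fin (k + 1) → ℕ) :
    tm s q (k + 1) m (Fin.snoc (α := fun _ => ℕ) n x) =
      q ^ (x * (m + 1)) * (qPoch q x)⁻¹ ^ 2 * tm s q k x n := by
  have h0 : (Fin.snoc (α := fun _ => ℕ) n x : Fin (k + 2) → ℕ) 0 = n 0 := by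
    rw [show (0 : Fin (k + 2)) = Fin.castSucc 0 from rfl, Fin.snoc_castSucc]
  simp only [tm, h0]
  rw [Fin.sum_univ_castSucc, Fin.sum_univ_castSucc (n := k + 1), Fin.prod_univ_castSucc (n := k + 1)]
  simp only [Fin.snoc_castSucc, Fin.snoc_last, Fin.succ_castSucc, Fin.succ_last]
  rw [div_eq_mul_inv, div_eq_mul_inv, mul_inv, inv_pow]
  ring

theorem tm_norm_le {q : ℂ} (hq : ‖q‖ < 1) (s : ℂ) (k m : ℕ) (n : Fin (k + 1) → ℕ) :
    ‖tm s q k m n‖ ≤ ‖tm s q k 0 n‖ := by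
  simp only [tm, norm_div, norm_mul, norm_pow, mul_zero, add_zero]
  gcongr ?_ * _ / _
  exact pow_le_pow_of_le_one (norm_nonneg _) hq.le (by omega)

theorem tm_sum {q : ℂ} (hq : ‖q‖ < 1) (s : ℂ) (k : ℕ) :
    ∀ m, Summable (fun n => ‖tm s q k m n‖) ∧ ∑' n, tm s q k m n = PP s q (k + 1) m := by
  induction k with
  | zero =>
    intro m
    obtain ⟨C, hC⟩ := bdd_PP hq s 0
    obtain ⟨B, hB, hB'⟩ := bdd_c2 hq hC
    have e : ∀ x : ℕ, tm s q 0 m ((Equiv.funUnique (Fin 1) ℕ).symm x)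
        = q ^ (x * (m + 1)) * ((qPoch q x)⁻¹ ^ 2 * PP s q 0 x) := by
      intro x
      simp [tm, PP, div_eq_mul_inv]
      ring
    constructor
    · rw [← (Equiv.funUnique (Fin 1) ℕ).symm.summable_iff]
      have := (summ_bd hq hB' m).norm
      refine this.congr fun x => ?_
      simp only [Function.comp]
      rw [e]
    · rw [← (Equiv.funUnique (Fin 1) ℕ).symm.tsum_eq, PP]
      exact tsum_congr e
  | succ k ih =>
    intro m
    obtain ⟨A, hA, hA'⟩ := bdd_inv hq
    have hA2 : ∀ n, ‖(qPoch q n)⁻¹ ^ 2‖ ≤ A ^ 2 := fun n => by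
      rw [norm_pow]; exact pow_le_pow_left₀ (norm_nonneg _) (hA' n) 2
    let e := Fin.snocEquiv (fun _ : Fin (k + 1 + 1) => ℕ)
    have he : ∀ p : ℕ × (Fin (k + 1) → ℕ), tm s q (k + 1) m (e p) =
        q ^ (p.1 * (m + 1)) * (qPoch q p.1)⁻¹ ^ 2 * tm s q k p.1 p.2 :=
      fun p => tm_snoc s q k m p.1 p.2
    have hS : Summable (fun p => ‖tm s q (k + 1) m (e p)‖) := by
      have hg : Summable fun p : ℕ × (Fin (k + 1) → ℕ) =>
          (‖q‖ ^ p.1 * A ^ 2) * ‖tm s q k 0 p.2‖ :=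
        ((summ_geo hq).mul_right (A ^ 2)).mul_of_nonneg (ih 0).1
          (fun n => by positivity) (fun n => norm_nonneg _)
      refine Summable.of_nonneg_of_le (fun _ => norm_nonneg _) (fun p => ?_) hg
      rw [he, norm_mul]
      exact mul_le_mul (norm_bd (g := fun n => (qPoch q n)⁻¹ ^ 2) hq hA2 m p.1)
        (tm_norm_le hq s k p.1 p.2) (norm_nonneg _) (by positivity)
    refine ⟨(e.summable_iff (f := fun n => ‖tm s q (k + 1) m n‖)).1 hS, ?_⟩
    rw [← e.tsum_eq, Summable.tsum_prod hS.of_norm, PP]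
    refine tsum_congr fun x => ?_
    simp only [he]
    rw [tsum_mul_left, (ih x).2, mul_assoc]

theorem summ_c {s : ℂ} (hs1 : ‖s‖ < 1) (k : ℕ) : Summable (fun r => ‖lam s r ^ k * al s r‖) := by
  refine Summable.of_nonneg_of_le (fun _ => norm_nonneg _) (fun r => ?_)
    ((summ_geo hs1).mul_right 2)
  have h1 : ‖lam s r‖ ≤ 1 := by
    simp only [lam, norm_mul, norm_pow, norm_neg, norm_one, one_pow, one_mul]
    exact pow_le_one₀ (norm_nonneg _) hs1.le
  have h2 : ‖1 - s ^ (2 * r + 1)‖ ≤ 2 := by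
    refine (norm_sub_le _ _).trans ?_
    rw [norm_one, norm_pow]
    have := pow_le_one₀ (n := 2 * r + 1) (norm_nonneg _) hs1.le
    linarith
  have h3 : ‖s‖ ^ (2 * r ^ 2 + r) ≤ ‖s‖ ^ r :=
    pow_le_pow_of_le_one (norm_nonneg _) hs1.le (by omega)
  rw [norm_mul, norm_pow, al, norm_mul, norm_mul, norm_pow, norm_pow, norm_neg, norm_one, one_pow,
    one_mul]
  calc ‖lam s r‖ ^ k * (‖s‖ ^ (2 * r ^ 2 + r) * ‖1 - s ^ (2 * r + 1)‖)
      ≤ 1 * (‖s‖ ^ r * 2) := by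
        gcongr
        exact pow_le_one₀ (norm_nonneg _) h1
    _ = _ := by ring

theorem theta {s : ℂ} (hs1 : ‖s‖ < 1) (k : ℕ) :
    ∑' n : ℤ, (if 0 ≤ n then (1 : ℂ) else (-1) ^ k) * (-1 : ℂ) ^ (((k : ℤ) + 1) * n) *
              s ^ (((k : ℤ) + 2) * n ^ 2 + ((k : ℤ) + 1) * n).toNat
      = ∑' r : ℕ, lam s r ^ k * al s r := by
  set f : ℤ → ℂ := fun n => (if 0 ≤ n then (1 : ℂ) else (-1) ^ k) * (-1 : ℂ) ^ (((k : ℤ) + 1) * n) *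
              s ^ (((k : ℤ) + 2) * n ^ 2 + ((k : ℤ) + 1) * n).toNat with hf
  have f1 : ∀ r : ℕ, f r = (-1) ^ ((k + 1) * r) * s ^ ((k + 2) * r ^ 2 + (k + 1) * r) := by
    intro r
    simp only [hf]
    rw [if_pos (by positivity), one_mul]
    congr 1
  have f2 : ∀ r : ℕ, f (-((r : ℤ) + 1)) =
      - ((-1) ^ ((k + 1) * r) * s ^ (k * (r * (r + 1)) + (2 * r ^ 2 + 3 * r + 1))) := by
    intro r
    simp only [hf]
    rw [if_neg (by omega)]
    have e1 : (((k : ℤ) + 2) * (-((r : ℤ) + 1)) ^ 2 + ((k : ℤ) + 1) * (-((r : ℤ) + 1))).toNat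
      = k * (r * (r + 1)) + (2 * r ^ 2 + 3 * r + 1) := by
      rw [show ((k : ℤ) + 2) * (-((r : ℤ) + 1)) ^ 2 + ((k : ℤ) + 1) * (-((r : ℤ) + 1))
        = ((k * (r * (r + 1)) + (2 * r ^ 2 + 3 * r + 1) : ℕ) : ℤ) by push_cast; ring]
      exact Int.toNat_natCast _
    have e2 : (-1 : ℂ) ^ (((k : ℤ) + 1) * (-((r : ℤ) + 1))) = (-1) ^ ((k + 1) * (r + 1)) := by
      rw [show ((k : ℤ) + 1) * (-((r : ℤ) + 1)) = -(((k + 1) * (r + 1) : ℕ) : ℤ) by push_cast; ring,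
        zpow_neg, zpow_natCast, ← inv_pow]
      norm_num
    rw [e1, e2]
    have e3 : (-1 : ℂ) ^ k * (-1) ^ k = 1 := by rw [← mul_pow]; norm_num
    have e4 : (-1 : ℂ) ^ ((k + 1) * (r + 1)) = (-1) ^ ((k + 1) * r) * (-1) ^ k * (-1) := by ring
    rw [e4]
    linear_combination (-(-1 : ℂ) ^ ((k + 1) * r) *
      s ^ (k * (r * (r + 1)) + (2 * r ^ 2 + 3 * r + 1))) * e3
  have bnd : ∀ (a b : ℕ), b ≤ a → ∀ c : ℕ, ‖(-1 : ℂ) ^ c * s ^ a‖ ≤ ‖s‖ ^ b := by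
    intro a b hab c
    rw [norm_mul, norm_pow, norm_pow, norm_neg, norm_one, one_pow, one_mul]
    exact pow_le_pow_of_le_one (norm_nonneg _) hs1.le hab
  have S1 : Summable (fun r : ℕ => f r) := by
    refine Summable.of_norm_bounded (summ_geo hs1) fun r => ?_
    rw [f1]
    exact bnd _ _ (by nlinarith [Nat.zero_le (k * r), Nat.zero_le ((k+2) * r ^ 2)]) _
  have S2 : Summable (fun r : ℕ => f (-((r : ℤ) + 1))) := by
    refine Summable.of_norm_bounded (summ_geo hs1) fun r => ?_
    rw [f2, norm_neg]
    exact bnd _ _ (by nlinarith [Nat.zero_le (k * (r * (r + 1))), Nat.zero_le (r ^ 2)]) _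
  rw [tsum_of_nat_of_neg_add_one S1 S2, ← S1.tsum_add S2]
  refine tsum_congr fun r => ?_
  rw [f1, f2, lam, al, mul_pow, ← pow_mul, ← pow_mul]
  ring

theorem main (k : ℕ) (q s : ℂ) (hs : s ^ 2 = q) (hq : ‖q‖ < 1) :
    PP s q k 0 = (∏' i : ℕ, (1 + s * q ^ i)) / qPochInf q ^ (k + 1) *
      ∑' r : ℕ, lam s r ^ k * al s r := by
  have hs1 : ‖s‖ < 1 := by
    have : ‖s‖ ^ 2 < 1 := by rw [← norm_pow, hs]; exact hq
    exact (sq_lt_one_iff₀ (norm_nonneg _)).1 this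
  have hE : ∀ n, 1 + s * q ^ n ≠ 0 := by
    intro n
    apply one_add_ne
    rw [norm_mul, norm_pow]
    have := pow_le_one₀ (n := n) (norm_nonneg _) hq.le
    nlinarith [norm_nonneg s]
  obtain ⟨C, hC⟩ := bdd_PP hq s k
  obtain ⟨B, hB, hB'⟩ := bdd_c hq hC
  have h1 := tannery hq hB'
  rw [qP_zero, inv_one, one_mul] at h1
  have h2 := (tend_BT hq _ (summ_c hs1 k)).const_mul
    ((∏' i : ℕ, (1 + s * q ^ i)) / qPochInf q ^ (k + 1))
  refine tendsto_nhds_unique h1 (h2.congr fun j => ?_)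
  rw [← RR_eq hs hq hE, RR]

end S19

/-- Theorem 4.3 (half-characteristic ε = 1/2): here `s` is a fixed square root of `q`. -/
theorem stmt19 (k : ℕ) (hk : 2 ≤ k) (q s : ℂ) (hs : s ^ 2 = q) (hq : ‖q‖ < 1) :
    ∑' n : Fin k → ℕ,
        q ^ ((∑ i : Fin (k - 1),
                n ⟨i.1, by have := i.isLt; omega⟩ * n ⟨i.1 + 1, by have := i.isLt; omega⟩) +
              ∑ i, n i) *
          (∏ i ∈ Finset.range (n ⟨0, by omega⟩), (1 + s * q ^ i))
          / ∏ i : Fin k, qPoch q (n i) ^ 2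
      = (∏' i : ℕ, (1 + s * q ^ i)) / qPochInf q ^ (k + 1) *
          ∑' n : ℤ,
            (if 0 ≤ n then (1 : ℂ) else (-1) ^ k) * (-1 : ℂ) ^ (((k : ℤ) + 1) * n) *
              s ^ (((k : ℤ) + 2) * n ^ 2 + ((k : ℤ) + 1) * n).toNat := by
  have hs1 : ‖s‖ < 1 := by
    have : ‖s‖ ^ 2 < 1 := by rw [← norm_pow, hs]; exact hq
    exact (sq_lt_one_iff₀ (norm_nonneg _)).1 this
  rw [S19.theta hs1, ← S19.main k q s hs hq]
  obtain ⟨k, rfl⟩ : ∃ k', k = k' + 1 := ⟨k - 1, by omega⟩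
  rw [← (S19.tm_sum hq s k 0).2]
  refine tsum_congr fun n => ?_
  rw [S19.tm, mul_zero, add_zero]
  rfl
end
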